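/- Fix n ≥ 2 and, for each i ∈ {1,…,n}, a twice differentiable cost function cᵢ : ℝ → ℝ with cᵢ(0) = 0, cᵢ'(z) > 0 for z > 0, and cᵢ''(z) ≥ 0 for z ≥ 0. Let x : ℝ → ℝⁿ and y : ℝ → ℝⁿ be differentiable, and for t ≥ 0 and each i write s₋ᵢ(t) = Σ_{j≠i} xⱼ(t). Suppose for every t ≥ 0 and every i: xᵢ(t) ≥ 0, s₋ᵢ(t) > 0, yᵢ(t) > 0, s₋ᵢ(t)/(yᵢ(t)+s₋ᵢ(t))² = cᵢ'(yᵢ(t)), and xᵢ'(t) = yᵢ(t) − xᵢ(t). Define V(t) = Σᵢ [ (yᵢ(t)/(yᵢ(t)+s₋ᵢ(t)) − cᵢ(yᵢ(t))) − (xᵢ(t)/(xᵢ(t)+s₋ᵢ(t)) − cᵢ(xᵢ(t))) ]. Then V(t) ≤ V(0)·e^{−t} for all t ≥ 0. In particular, for every ε > 0 and every t ≥ ln(V(0)/ε) (when V(0) > ε), every agent i has regret V_i(t) ≤ V(t) ≤ ε, i.e., x(t) is an ε-approximate pure-strategy Nash equilibrium. -/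

import Mathlib

open Finset

/-- Total output of the agents other than `i` at time `t`. -/
noncomputable def othersSum (n : ℕ) (x : ℝ → Fin n → ℝ) (t : ℝ) (i : Fin n) : ℝ :=
  ∑ j ∈ Finset.univ.erase i, x t j

/-- Agent `i`'s regret at time `t`: the utility gain from switching from the current
action `x t i` to the best response `y t i`. -/
noncomputable def regret (n : ℕ) (c : Fin n → ℝ → ℝ) (x y : ℝ → Fin n → ℝ)
    (t : ℝ) (i : Fin n) : ℝ :=
  (y t i / (y t i + othersSum n x t i) - c i (y t i)) -
    (x t i / (x t i + othersSum n x t i) - c i (x t i))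

/-- The total-regret Lyapunov potential of the continuous-time best-response dynamics. -/
noncomputable def potential (n : ℕ) (c : Fin n → ℝ → ℝ) (x y : ℝ → Fin n → ℝ) (t : ℝ) : ℝ :=
  ∑ i, regret n c x y t i

/-- A twice differentiable function whose second derivative is nonnegative on `[0, ∞)` lies
above its tangent lines there. -/
theorem deriv_mul_sub_le_of_deriv2_nonneg {f : ℝ → ℝ} (hf : Differentiable ℝ f)
    (hf' : Differentiable ℝ (deriv f)) (hf'' : ∀ z : ℝ, 0 ≤ z → 0 ≤ deriv (deriv f) z)
    {a b : ℝ} (ha : 0 ≤ a) (hb : 0 ≤ b) : deriv f a * (b - a) ≤ f b - f a := by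
  have hconv : ConvexOn ℝ (Set.Ici 0) f :=
    convexOn_of_deriv2_nonneg' (convex_Ici 0) hf.differentiableOn hf'.differentiableOn
      fun z hz => hf'' z hz
  rcases lt_trichotomy a b with h | rfl | h
  · have := hconv.le_slope_of_hasDerivAt ha hb h (hf a).hasDerivAt
    rwa [slope_def_field, le_div_iff₀ (sub_pos.2 h)] at this
  · simp
  · have := hconv.slope_le_of_hasDerivAt hb ha h (hf a).hasDerivAt
    rw [slope_def_field, div_le_iff₀ (sub_pos.2 h)] at this
    linarith

/-- A reply satisfying the first-order condition is a best reply when the cost is convex. -/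
theorem tullock_regret_nonneg {f : ℝ → ℝ} (hf : Differentiable ℝ f)
    (hf' : Differentiable ℝ (deriv f)) (hf'' : ∀ z : ℝ, 0 ≤ z → 0 ≤ deriv (deriv f) z)
    {a b s : ℝ} (ha : 0 ≤ a) (hb : 0 < b) (hs : 0 < s) (hfoc : s / (b + s) ^ 2 = deriv f b) :
    0 ≤ (b / (b + s) - f b) - (a / (a + s) - f a) := by
  have h := deriv_mul_sub_le_of_deriv2_nonneg hf hf' hf'' hb.le ha
  have key : b / (b + s) - a / (a + s) + s / (b + s) ^ 2 * (a - b) =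
      s * (b - a) ^ 2 / ((b + s) ^ 2 * (a + s)) := by
    field_simp
    ring
  have : 0 ≤ s * (b - a) ^ 2 / ((b + s) ^ 2 * (a + s)) := by positivity
  rw [← hfoc] at h
  linarith

/-- The sum of Tullock winning probabilities of the replies, corrected by the motion of the
opponents, is at most one. -/
theorem sum_reply_share_sub_le_one {ι : Type*} [Fintype ι] [Nonempty ι] {p d : ι → ℝ}
    (hp : ∀ i, 0 < p i) (hd : ∀ i, 0 < d i) :
    ∑ i, p i * (2 * d i - ∑ j, p j) / d i ^ 2 ≤ 1 := by
  have hT : 0 < ∑ j, p j := Finset.sum_pos (fun j _ => hp j) Finset.univ_nonempty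
  calc ∑ i, p i * (2 * d i - ∑ j, p j) / d i ^ 2 ≤ ∑ i, p i / ∑ j, p j := by
        refine Finset.sum_le_sum fun i _ => ?_
        rw [div_le_div_iff₀ (pow_pos (hd i) 2) hT, mul_assoc]
        refine mul_le_mul_of_nonneg_left ?_ (hp i).le
        nlinarith [sq_nonneg (d i - ∑ j, p j)]
    _ = 1 := by rw [← Finset.sum_div, div_self hT.ne']

/-- Static form of the Lyapunov inequality: the derivative of the total regret along the
dynamics, plus the total regret net of costs, is nonpositive. -/
theorem sum_share_variation_nonpos {ι : Type*} [Fintype ι] [Nonempty ι] {a b s r : ι → ℝ}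
    (ha : ∀ i, 0 ≤ a i) (hb : ∀ i, 0 < b i) (hs : ∀ i, 0 < s i)
    (hsum : ∀ i, s i = ∑ j, a j - a i) (hr : ∀ i, r i = ∑ j, (b j - a j) - (b i - a i)) :
    ∑ i, (b i / (b i + s i) - a i / (a i + s i) - b i * r i / (b i + s i) ^ 2
      - (s i * (b i - a i) - a i * r i) / (a i + s i) ^ 2) ≤ 0 := by
  have hS : 0 < ∑ j, a j := by
    obtain ⟨i⟩ := ‹Nonempty ι›
    linarith [hs i, hsum i, ha i]
  set S := ∑ j, a j with hSdef
  have hd : ∀ i, 0 < b i + s i := fun i => add_pos (hb i) (hs i)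
  have hterm : ∀ i, b i / (b i + s i) - a i / (a i + s i) - b i * r i / (b i + s i) ^ 2
      - (s i * (b i - a i) - a i * r i) / (a i + s i) ^ 2 =
      b i * (2 * (b i + s i) - ∑ j, b j) / (b i + s i) ^ 2 - a i / S
        - (S * (b i - a i) - a i * ∑ j, (b j - a j)) / S ^ 2 := by
    intro i
    have h1 : a i + s i = S := by rw [hsum i]; ring
    have h2 : ∑ j, b j = 2 * (b i + s i) - (b i + s i) + r i := by
      rw [hr i, Finset.sum_sub_distrib, hsum i]; ring
    have h3 : s i * (b i - a i) - a i * r i = S * (b i - a i) - a i * ∑ j, (b j - a j) := by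
      rw [hr i, hsum i]; ring
    have h4 := (hd i).ne'
    rw [h1, h2, h3]
    field_simp
    ring
  have hzero : ∑ i, (S * (b i - a i) - a i * ∑ j, (b j - a j)) / S ^ 2 = 0 := by
    rw [← Finset.sum_div, Finset.sum_sub_distrib, ← Finset.mul_sum, ← Finset.sum_mul, ← hSdef,
      sub_self, zero_div]
  rw [Finset.sum_congr rfl fun i _ => hterm i, Finset.sum_sub_distrib, Finset.sum_sub_distrib,
    hzero, ← Finset.sum_div, ← hSdef, div_self hS.ne']
  linarith [sum_reply_share_sub_le_one hb hd]

/-- Derivative of a Tullock utility when both the own action and the opponents' total move. -/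
theorem hasDerivAt_tullock_utility {f u s : ℝ → ℝ} {u' s' t : ℝ} (hf : Differentiable ℝ f)
    (hu : HasDerivAt u u' t) (hs : HasDerivAt s s' t) (hne : u t + s t ≠ 0) :
    HasDerivAt (fun τ => u τ / (u τ + s τ) - f (u τ))
      ((s t * u' - u t * s') / (u t + s t) ^ 2 - deriv f (u t) * u') t := by
  have h := (hu.div (hu.add hs) hne).sub ((hf (u t)).hasDerivAt.comp t hu)
  refine h.congr_deriv ?_
  simp only [Pi.add_apply]
  ring

/-- A function with `g' ≤ -g` on `[0, ∞)` decays at least like `exp (-t)`. -/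
theorem le_mul_exp_neg_of_hasDerivAt_le_neg {g g' : ℝ → ℝ}
    (hg : ∀ t, 0 ≤ t → HasDerivAt g (g' t) t) (hle : ∀ t, 0 ≤ t → g' t ≤ -g t)
    {t : ℝ} (ht : 0 ≤ t) : g t ≤ g 0 * Real.exp (-t) := by
  have hder : ∀ τ, 0 ≤ τ →
      HasDerivAt (fun τ => g τ * Real.exp τ) (g' τ * Real.exp τ + g τ * Real.exp τ) τ :=
    fun τ hτ => (hg τ hτ).mul (Real.hasDerivAt_exp τ)
  have hanti : AntitoneOn (fun τ => g τ * Real.exp τ) (Set.Ici 0) := by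
    refine antitoneOn_of_deriv_nonpos (convex_Ici 0)
      (fun τ hτ => (hder τ hτ).continuousAt.continuousWithinAt)
      (fun τ hτ => (hder τ (interior_subset hτ)).differentiableAt.differentiableWithinAt)
      fun τ hτ => ?_
    rw [(hder τ (interior_subset hτ)).deriv]
    nlinarith [hle τ (interior_subset hτ), Real.exp_pos τ]
  have h := hanti (Set.mem_Ici.2 le_rfl) (Set.mem_Ici.2 ht) ht
  simp only [Real.exp_zero, mul_one] at h
  rwa [Real.exp_neg, ← div_eq_mul_inv, le_div_iff₀ (Real.exp_pos t)]

/-- Exponential convergence of the continuous-time best-response dynamics in Tullock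
contests with convex costs: along the dynamics `xᵢ' = yᵢ − xᵢ` (best responses `yᵢ`
interior), the total-regret potential satisfies `V(t) ≤ V(0)·e^{−t}` for `t ≥ 0`;
in particular, for every `ε > 0` with `ε < V(0)` and every `t ≥ ln(V(0)/ε)`, every
agent's regret is at most `ε`, i.e. `x(t)` is an `ε`-approximate pure-strategy Nash
equilibrium. -/
theorem tullock_exponential_convergence (n : ℕ) (hn : 2 ≤ n) (c : Fin n → ℝ → ℝ)
    (hc : ∀ i, Differentiable ℝ (c i)) (hc' : ∀ i, Differentiable ℝ (deriv (c i)))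
    (hc0 : ∀ i, c i 0 = 0) (hcpos : ∀ i, ∀ z : ℝ, 0 < z → 0 < deriv (c i) z)
    (hc'' : ∀ i, ∀ z : ℝ, 0 ≤ z → 0 ≤ deriv (deriv (c i)) z)
    (x y : ℝ → Fin n → ℝ)
    (hx : ∀ i, Differentiable ℝ fun t => x t i)
    (hy : ∀ i, Differentiable ℝ fun t => y t i)
    (hxnn : ∀ t : ℝ, 0 ≤ t → ∀ i, 0 ≤ x t i)
    (hspos : ∀ t : ℝ, 0 ≤ t → ∀ i, 0 < othersSum n x t i)
    (hypos : ∀ t : ℝ, 0 ≤ t → ∀ i, 0 < y t i)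
    (hfoc : ∀ t : ℝ, 0 ≤ t → ∀ i,
      othersSum n x t i / (y t i + othersSum n x t i) ^ 2 = deriv (c i) (y t i))
    (hdx : ∀ t : ℝ, 0 ≤ t → ∀ i, HasDerivAt (fun t => x t i) (y t i - x t i) t) :
    (∀ t : ℝ, 0 ≤ t → potential n c x y t ≤ potential n c x y 0 * Real.exp (-t)) ∧
      ∀ ε : ℝ, 0 < ε → ε < potential n c x y 0 →
        ∀ t : ℝ, Real.log (potential n c x y 0 / ε) ≤ t →
          ∀ i, regret n c x y t i ≤ ε := by
  have : Nonempty (Fin n) := ⟨⟨0, by omega⟩⟩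
  have hs : ∀ t i, othersSum n x t i = ∑ j, x t j - x t i := fun t i => by
    rw [othersSum, Finset.sum_erase_eq_sub (Finset.mem_univ i)]
  have hds : ∀ t : ℝ, 0 ≤ t → ∀ i, HasDerivAt (fun τ => othersSum n x τ i)
      (∑ j, (y t j - x t j) - (y t i - x t i)) t := fun t ht i => by
    simp only [hs]
    exact (HasDerivAt.fun_sum fun j _ => hdx t ht j).sub (hdx t ht i)
  have hdV := fun (t : ℝ) (ht : 0 ≤ t) => HasDerivAt.fun_sum (u := Finset.univ) fun i _ =>
    (hasDerivAt_tullock_utility (hc i) (hy i t).hasDerivAt (hds t ht i)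
      (add_pos (hypos t ht i) (hspos t ht i)).ne').sub
    (hasDerivAt_tullock_utility (hc i) (hdx t ht i) (hds t ht i)
      (add_pos_of_nonneg_of_pos (hxnn t ht i) (hspos t ht i)).ne')
  have hdecay : ∀ t : ℝ, 0 ≤ t →
      potential n c x y t ≤ potential n c x y 0 * Real.exp (-t) := by
    intro t ht
    refine le_mul_exp_neg_of_hasDerivAt_le_neg (g := potential n c x y) hdV (fun τ hτ => ?_) ht
    have hvar := sum_share_variation_nonpos (hxnn τ hτ) (hypos τ hτ) (hspos τ hτ) (hs τ)
      (fun _ => rfl)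
    rw [le_neg_iff_add_nonpos_right, potential, ← Finset.sum_add_distrib]
    refine le_trans (Finset.sum_le_sum fun i _ => ?_) hvar
    have htan := deriv_mul_sub_le_of_deriv2_nonneg (hc i) (hc' i) (hc'' i) (hxnn τ hτ i)
      (hypos τ hτ i).le
    rw [regret, ← hfoc τ hτ i]
    ring_nf at htan ⊢
    linarith
  refine ⟨hdecay, fun ε hε hεV t ht i => ?_⟩
  have hV0 : 0 < potential n c x y 0 := hε.trans hεV
  have ht0 : 0 ≤ t := (Real.log_nonneg ((one_le_div hε).2 hεV.le)).trans ht
  have hsingle : regret n c x y t i ≤ potential n c x y t :=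
    Finset.single_le_sum (f := regret n c x y t) (fun j _ => tullock_regret_nonneg (hc j) (hc' j)
      (hc'' j) (hxnn t ht0 j) (hypos t ht0 j) (hspos t ht0 j) (hfoc t ht0 j)) (Finset.mem_univ i)
  have hexp : potential n c x y 0 / ε ≤ Real.exp t :=
    (Real.log_le_iff_le_exp (div_pos hV0 hε)).1 ht
  refine (hsingle.trans (hdecay t ht0)).trans ?_
  rw [Real.exp_neg, ← div_eq_mul_inv, div_le_iff₀ (Real.exp_pos t)]
  linarith [(div_le_iff₀ hε).1 hexp]
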